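/- arXiv:2202.02086 — 4 statements merged into one kernel-verified Lean document; each statement's English description precedes it below -/
import Mathlib

section
/- Let F be a finite field with q elements and let C₁, C₂ be full-length linear [n,k] codes over F with generator matrices G₁, G₂ ∈ F^{k×n} of rank k having nonzero columns. For a generator matrix G with columns g₁,…,gₙ, define the binary matrix N(A_G), with rows indexed by the points of PG(k−1,q) and columns indexed by {1,…,n}, by N(A_G)(p, j) = 1 if ⟨rep(p), g_j⟩ ≠ 0 and N(A_G)(p, j) = 0 otherwise (this is independent of the representative rep(p)). If C₁ and C₂ are equivalent (there exist a permutation π of the coordinates, nonzero scalars λ₁,…,λₙ ∈ F, and a field automorphism ρ of F with C₂ = { (j ↦ ρ(λ_j · c_{π(j)})) : c ∈ C₁ }), then the binary matrices N(A_{G₁}) and N(A_{G₂}) are isomorphic, i.e., there exist a bijection of the row index sets and a permutation of the column index set transforming N(A_{G₁}) into N(A_{G₂}). -/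
/-- A matrix whose rank equals its number of rows acts injectively on row vectors. -/
theorem Matrix.vecMul_injective_of_rank_eq {F : Type*} [Field F] {k n : ℕ}
    (G : Matrix (Fin k) (Fin n) F) (h : G.rank = k) : Function.Injective G.vecMul := by
  rw [Matrix.vecMul_injective_iff, linearIndependent_iff_card_eq_finrank_span, Fintype.card_fin,
    Set.finrank, ← Matrix.rank_eq_finrank_span_row, h]

/-- The pairing of a representative of `[v]` with a vector vanishes iff that of `v` does. -/
theorem Projectivization.vecMul_rep_mk_eq_zero_iff {F : Type*} [Field F] {k n : ℕ}
    (G : Matrix (Fin k) (Fin n) F) (v : Fin k → F) (hv : v ≠ 0) (j : Fin n) :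
    Matrix.vecMul (Projectivization.mk F v hv).rep G j = 0 ↔ Matrix.vecMul v G j = 0 := by
  obtain ⟨a, ha⟩ := Projectivization.exists_smul_eq_mk_rep F v hv
  rw [← ha, Units.smul_def, Matrix.smul_vecMul]
  simp

/-- If two full-length linear `[n,k]` codes over a finite field are
equivalent, then the binary matrices `N(A_{G₁})` and `N(A_{G₂})` (rows indexed by the points of
`PG(k-1,q)`, columns by coordinates, with entry 1 iff the bilinear form of the point
representative with the column is nonzero) are isomorphic, i.e. equal up to a bijection of the
rows and a permutation of the columns. -/
theorem stmt1 {F : Type*} [Field F] [Fintype F] [DecidableEq F] {k n : ℕ}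
    (G₁ G₂ : Matrix (Fin k) (Fin n) F)
    (hrank₁ : G₁.rank = k) (hrank₂ : G₂.rank = k)
    (hcol₁ : ∀ j, (fun i => G₁ i j) ≠ 0) (hcol₂ : ∀ j, (fun i => G₂ i j) ≠ 0)
    (N : Matrix (Fin k) (Fin n) F → Projectivization F (Fin k → F) → Fin n → ℕ)
    (hN : ∀ G p j, N G p j = if (∑ i, p.rep i * G i j) ≠ 0 then 1 else 0)
    (hequiv : ∃ (π : Equiv.Perm (Fin n)) (lam : Fin n → F) (ρ : F ≃+* F),
        (∀ j, lam j ≠ 0) ∧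
        {v | ∃ u : Fin k → F, v = Matrix.vecMul u G₂}
          = {w | ∃ c ∈ {v | ∃ u : Fin k → F, v = Matrix.vecMul u G₁},
              w = fun j => ρ (lam j * c (π j))}) :
    ∃ (re : Equiv.Perm (Projectivization F (Fin k → F))) (ce : Equiv.Perm (Fin n)),
      ∀ p j, N G₁ p j = N G₂ (re p) (ce j) := by
  obtain ⟨π, lam, ρ, hlam, hcodes⟩ := hequiv
  have hinj₁ := G₁.vecMul_injective_of_rank_eq hrank₁
  have hinj₂ := G₂.vecMul_injective_of_rank_eq hrank₂
  have hex (u : Fin k → F) : ∃ u' : Fin k → F,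
      ∀ j, Matrix.vecMul u' G₂ j = ρ (lam j * Matrix.vecMul u G₁ (π j)) := by
    obtain ⟨u', hu'⟩ := hcodes.ge ⟨_, ⟨u, rfl⟩, rfl⟩
    exact ⟨u', fun j => (congrFun hu' j).symm⟩
  choose σ hσ using hex
  let T : (Fin k → F) →ₛₗ[(ρ : F →+* F)] (Fin k → F) :=
    { toFun := σ
      map_add' := fun u v => hinj₂ <| funext fun j => by
        simp [Matrix.add_vecMul, hσ, mul_add]
      map_smul' := fun a u => hinj₂ <| funext fun j => by
        simp [Matrix.smul_vecMul, hσ, mul_left_comm] }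
  have hT : Function.Injective T := fun u v huv => hinj₁ <| funext fun j => by
    have h : Matrix.vecMul (σ u) G₂ (π.symm j) = Matrix.vecMul (σ v) G₂ (π.symm j) :=
      congrArg (fun w => Matrix.vecMul w G₂ (π.symm j)) huv
    simpa [hσ, hlam] using h
  have : RingHomInvPair (ρ : F →+* F) (ρ.symm : F →+* F) := RingHomInvPair.of_ringEquiv ρ
  have hbij : Function.Bijective (Projectivization.map T hT) :=
    Finite.injective_iff_bijective.mp
      (Projectivization.map_injective (τ := (ρ.symm : F →+* F)) T hT)
  refine ⟨Equiv.ofBijective _ hbij, π.symm, fun p j => ?_⟩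
  have hp : Projectivization.map T hT p =
      Projectivization.mk F (σ p.rep) ((map_ne_zero_iff T hT).mpr p.rep_nonzero) := by
    conv_lhs => rw [← p.mk_rep]
    rfl
  have key : Matrix.vecMul (Projectivization.map T hT p).rep G₂ (π.symm j) = 0 ↔
      Matrix.vecMul p.rep G₁ j = 0 := by
    rw [hp, Projectivization.vecMul_rep_mk_eq_zero_iff, hσ]
    simp [hlam]
  rw [hN, hN, Equiv.ofBijective_apply]
  exact if_congr (not_congr key.symm) rfl rfl
end

section
/- Let F be a finite field with q elements and let C₁, C₂ be full-length linear [n,k] codes over F with generator matrices G₁, G₂ ∈ F^{k×n} of rank k having nonzero columns, and let M₁, M₂ be the multisets of points of PG(k−1,q) formed by the projectivization classes of the columns of G₁ and G₂ respectively. Then C₁ and C₂ are equivalent (there exist a permutation π of the coordinates, nonzero scalars λ₁,…,λₙ ∈ F, and a field automorphism ρ of F with C₂ = { (j ↦ ρ(λ_j · c_{π(j)})) : c ∈ C₁ }) if and only if there exist a field automorphism ρ of F and a bijective ρ-semilinear map T : F^k → F^k whose induced map on PG(k−1,q) (sending the class of x to the class of T(x)) carries the multiset M₁ onto the multiset M₂.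 -/
/-- Two finite families with the same multiset of values differ by a permutation of the indices. -/
theorem exists_perm_comp_eq_of_map_univ_eq {ι X : Type*} [Fintype ι] {f g : ι → X}
    (h : Finset.univ.val.map f = Finset.univ.val.map g) :
    ∃ π : Equiv.Perm ι, ∀ j, f (π j) = g j := by
  classical
  have e : ∀ c, Nonempty ({a // g a = c} ≃ {b // f b = c}) := fun c => by
    refine ⟨Fintype.equivOfCardEq ?_⟩
    have hc := congrArg (Multiset.count c) h
    simp only [Multiset.count_map] at hc
    simp only [Fintype.card_subtype, Finset.card_def, Finset.filter_val, eq_comm (b := c)]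
    exact hc.symm
  exact ⟨Equiv.ofFiberEquiv fun c => (e c).some, fun j => Equiv.ofFiberEquiv_map _ j⟩

/-- The matrix obtained from `G` by permuting and rescaling the columns and then applying a field
automorphism to all entries. -/
def monomialTwist {F : Type*} [Field F] {k n : ℕ} (G : Matrix (Fin k) (Fin n) F)
    (π : Equiv.Perm (Fin n)) (lam : Fin n → F) (ρ : F ≃+* F) : Matrix (Fin k) (Fin n) F :=
  Matrix.of fun i j => ρ (lam j * G i (π j))

theorem vecMul_monomialTwist {F : Type*} [Field F] {k n : ℕ} (G : Matrix (Fin k) (Fin n) F)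
    (π : Equiv.Perm (Fin n)) (lam : Fin n → F) (ρ : F ≃+* F) (u : Fin k → F) :
    Matrix.vecMul (fun i => ρ (u i)) (monomialTwist G π lam ρ) =
      fun j => ρ (lam j * Matrix.vecMul u G (π j)) := by
  ext j
  simp only [Matrix.vecMul, dotProduct, monomialTwist, Matrix.of_apply, Finset.mul_sum, map_sum,
    map_mul]
  exact Finset.sum_congr rfl fun i _ => by ring

theorem mulVec_monomialTwist_col {F : Type*} [Field F] {k n : ℕ} (G : Matrix (Fin k) (Fin n) F)
    (π : Equiv.Perm (Fin n)) (lam : Fin n → F) (ρ : F ≃+* F) (A : Matrix (Fin k) (Fin k) F)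
    (j : Fin n) :
    (fun i => (A * monomialTwist G π lam ρ) i j) =
      ρ (lam j) • A.mulVec (fun i => ρ (G i (π j))) := by
  ext i
  simp only [Matrix.mul_apply, monomialTwist, Matrix.of_apply, Matrix.mulVec, dotProduct,
    Pi.smul_apply, smul_eq_mul, Finset.mul_sum, map_mul]
  exact Finset.sum_congr rfl fun i _ => by ring

/-- The image of a row space under a monomial semilinear map is the row space of the twisted
matrix. -/
theorem setOf_exists_rowSpace_eq {F : Type*} [Field F] {k n : ℕ} (G : Matrix (Fin k) (Fin n) F)
    (π : Equiv.Perm (Fin n)) (lam : Fin n → F) (ρ : F ≃+* F) :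
    {w | ∃ c ∈ {v | ∃ u : Fin k → F, v = Matrix.vecMul u G}, w = fun j => ρ (lam j * c (π j))} =
      {v | ∃ u : Fin k → F, v = Matrix.vecMul u (monomialTwist G π lam ρ)} := by
  ext w
  constructor
  · rintro ⟨_, ⟨u, rfl⟩, rfl⟩
    exact ⟨_, (vecMul_monomialTwist G π lam ρ u).symm⟩
  · rintro ⟨u, rfl⟩
    refine ⟨_, ⟨fun i => ρ.symm (u i), rfl⟩, ?_⟩
    rw [← vecMul_monomialTwist]
    simp

/-- A matrix of full row rank has the same row space as another one of the same size iff they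
differ by left multiplication by an invertible matrix. -/
theorem rowSpace_eq_iff_exists_isUnit_mul {F : Type*} [Field F] {k n : ℕ}
    {G H : Matrix (Fin k) (Fin n) F} (hG : G.rank = k) :
    {v | ∃ u : Fin k → F, v = Matrix.vecMul u G} = {v | ∃ u : Fin k → F, v = Matrix.vecMul u H} ↔
      ∃ A : Matrix (Fin k) (Fin k) F, IsUnit A ∧ G = A * H := by
  constructor
  · intro h
    have hrow : ∀ i, ∃ u : Fin k → F, G i = Matrix.vecMul u H := fun i =>
      h.subset ⟨Pi.single i 1, by simp [Matrix.row]⟩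
    choose A hA using hrow
    have hGA : G = Matrix.of A * H := by
      ext i j
      rw [hA i]
      rfl
    refine ⟨Matrix.of A, ?_, hGA⟩
    rw [← Matrix.mulVec_surjective_iff_isUnit]
    have hle : k ≤ (Matrix.of A).rank := by
      conv_lhs => rw [← hG, hGA]
      exact Matrix.rank_mul_le_left _ _
    have htop : LinearMap.range (Matrix.of A).mulVecLin = ⊤ := by
      apply Submodule.eq_top_of_finrank_eq
      apply le_antisymm (Submodule.finrank_le _)
      simpa [Matrix.rank] using hle
    exact LinearMap.range_eq_top.mp htop
  · rintro ⟨A, hA, rfl⟩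
    ext v
    constructor
    · rintro ⟨u, rfl⟩
      exact ⟨Matrix.vecMul u A, by rw [Matrix.vecMul_vecMul]⟩
    · rintro ⟨u, rfl⟩
      obtain ⟨w, rfl⟩ := Matrix.vecMul_surjective_iff_isUnit.mpr hA u
      exact ⟨w, by rw [Matrix.vecMul_vecMul]⟩

/-- A semilinear self-map of `F^k` is a matrix applied to the conjugated vector. -/
theorem eq_mulVec_of_semilinear {F : Type*} [Field F] {k : ℕ} (ρ : F ≃+* F)
    (T : (Fin k → F) →ₛₗ[(ρ : F →+* F)] (Fin k → F)) (x : Fin k → F) :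
    T x = (Matrix.of fun i l => T (Pi.single l 1) i).mulVec (fun i => ρ (x i)) := by
  conv_lhs => rw [pi_eq_sum_univ' x]
  ext i
  simp [Matrix.mulVec, dotProduct, mul_comm]

/-- The semilinear map `x ↦ A (ρ x)`. -/
def twistedMulVec {F : Type*} [Field F] {k : ℕ} (ρ : F ≃+* F) (A : Matrix (Fin k) (Fin k) F) :
    (Fin k → F) →ₛₗ[(ρ : F →+* F)] (Fin k → F) where
  toFun x := A.mulVec fun i => ρ (x i)
  map_add' x y := by
    rw [← Matrix.mulVec_add]
    congr 1
    ext i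
    simp
  map_smul' c x := by
    rw [← Matrix.mulVec_smul]
    congr 1
    ext i
    simp

theorem twistedMulVec_bijective_iff {F : Type*} [Field F] {k : ℕ} (ρ : F ≃+* F)
    (A : Matrix (Fin k) (Fin k) F) :
    Function.Bijective (twistedMulVec ρ A) ↔ IsUnit A := by
  have h : ⇑(twistedMulVec ρ A) = A.mulVec ∘ (Equiv.piCongrRight fun _ : Fin k => ρ.toEquiv) := rfl
  rw [h, Function.Bijective.of_comp_iff _ (Equiv.bijective _), Function.Bijective,
    Matrix.mulVec_injective_iff_isUnit, Matrix.mulVec_surjective_iff_isUnit, and_self]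


/-- Two full-length linear `[n,k]` codes over a finite field `F` are
equivalent iff there is a bijective `ρ`-semilinear map `T : F^k → F^k` whose induced map on
`PG(k-1,q)` carries the multiset of points of the first generator matrix onto that of the
second. -/
theorem stmt2 {F : Type*} [Field F] [Fintype F] {k n : ℕ}
    (G₁ G₂ : Matrix (Fin k) (Fin n) F)
    (hrank₁ : G₁.rank = k) (hrank₂ : G₂.rank = k)
    (hcol₁ : ∀ j, (fun i => G₁ i j) ≠ 0) (hcol₂ : ∀ j, (fun i => G₂ i j) ≠ 0) :
    (∃ (π : Equiv.Perm (Fin n)) (lam : Fin n → F) (ρ : F ≃+* F),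
        (∀ j, lam j ≠ 0) ∧
        {v | ∃ u : Fin k → F, v = Matrix.vecMul u G₂}
          = {w | ∃ c ∈ {v | ∃ u : Fin k → F, v = Matrix.vecMul u G₁},
              w = fun j => ρ (lam j * c (π j))}) ↔
    (∃ (ρ : F ≃+* F) (T : (Fin k → F) → (Fin k → F))
        (Tbar : Projectivization F (Fin k → F) → Projectivization F (Fin k → F)),
        Function.Bijective T ∧
        (∀ x y, T (x + y) = T x + T y) ∧
        (∀ (α : F) (x : Fin k → F), T (α • x) = ρ α • T x) ∧
        (∀ (x : Fin k → F) (hx : x ≠ 0) (hTx : T x ≠ 0),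
          Tbar (Projectivization.mk F x hx) = Projectivization.mk F (T x) hTx) ∧
        Multiset.map Tbar
            (Finset.univ.val.map fun j => Projectivization.mk F (fun i => G₁ i j) (hcol₁ j))
          = Finset.univ.val.map fun j => Projectivization.mk F (fun i => G₂ i j) (hcol₂ j)) := by
  simp only [setOf_exists_rowSpace_eq, rowSpace_eq_iff_exists_isUnit_mul hrank₂]
  constructor
  · rintro ⟨π, lam, ρ, hlam, A, hA, hG⟩
    have hT := (twistedMulVec_bijective_iff ρ A).mpr hA
    refine ⟨ρ, twistedMulVec ρ A, Projectivization.map (twistedMulVec ρ A) hT.injective, hT,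
      map_add _, fun α x => map_smulₛₗ _ α x, fun x hx hTx => Projectivization.map_mk _ _ _ _, ?_⟩
    have hcol : ∀ j, Projectivization.mk F (fun i => G₂ i j) (hcol₂ j) =
        Projectivization.map (twistedMulVec ρ A) hT.injective
          (Projectivization.mk F (fun i => G₁ i (π j)) (hcol₁ (π j))) := fun j => by
      rw [Projectivization.map_mk, Projectivization.mk_eq_mk_iff']
      refine ⟨ρ (lam j), ?_⟩
      rw [hG, mulVec_monomialTwist_col]
      rfl
    simp only [hcol, Multiset.map_map]
    rw [← Multiset.map_univ_val_equiv π, Multiset.map_map, Multiset.map_univ_val_equiv π]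
    rfl
  · rintro ⟨ρ, T, Tbar, hT, hadd, hsmul, hTbar, hM⟩
    let T' : (Fin k → F) →ₛₗ[(ρ : F →+* F)] (Fin k → F) := ⟨⟨T, hadd⟩, hsmul⟩
    obtain ⟨A, hTA⟩ : ∃ A, T' = twistedMulVec ρ A :=
      ⟨_, LinearMap.ext (eq_mulVec_of_semilinear ρ T')⟩
    have hA : IsUnit A := (twistedMulVec_bijective_iff ρ A).mp (hTA ▸ hT)
    have hT0 : ∀ x, x ≠ 0 → T x ≠ 0 := fun x hx => (map_ne_zero_iff T' hT.injective).mpr hx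
    rw [Multiset.map_map] at hM
    obtain ⟨π, hπ⟩ := exists_perm_comp_eq_of_map_univ_eq hM
    have hmu : ∀ j, ∃ a : Fˣ, a • T (fun i => G₁ i (π j)) = fun i => G₂ i j := fun j => by
      have h := hπ j
      rw [Function.comp_apply, hTbar _ _ (hT0 _ (hcol₁ _)), eq_comm,
        Projectivization.mk_eq_mk_iff] at h
      exact h
    choose μ hμ using hmu
    refine ⟨π, fun j => ρ.symm (μ j), ρ, fun j => by simp, A, hA, ?_⟩
    ext i j
    have h := congrFun (mulVec_monomialTwist_col G₁ π (fun j => ρ.symm (μ j)) ρ A j) i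
    rw [h, ← congrFun (hμ j) i, ρ.apply_symm_apply]
    have hx := LinearMap.congr_fun hTA fun i => G₁ i (π j)
    exact congrArg (fun v : Fin k → F => ((μ j : F) • v) i) hx
end

section
/- (Fundamental Theorem of Galois Geometry.) Let F be a finite field with q elements and n ≥ 2, and let f be a bijection of the point set of PG(n,q) such that for all points a, b, c of PG(n,q): c lies in the projective subspace spanned by a and b if and only if f(c) lies in the projective subspace spanned by f(a) and f(b). Then there exist a field automorphism ρ of F and a bijective ρ-semilinear map g : F^{n+1} → F^{n+1} (equivalently, an invertible (n+1)×(n+1) matrix A over F together with ρ) such that for every nonzero x ∈ F^{n+1}, f([x]) = [g(x)] = [A·ρ(x)], where ρ is applied to x coordinatewise. -/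
open Submodule

section SpanPreserving

variable {K V : Type*} [Field K] [AddCommGroup V] [Module K V]

/-- `φ` preserves and reflects membership in the span of two vectors. -/
def SpanPreserving (K : Type*) {V : Type*} [Field K] [AddCommGroup V] [Module K V]
    (φ : V → V) : Prop :=
  φ 0 = 0 ∧ ∀ x y z, z ∈ span K {x, y} ↔ φ z ∈ span K {φ x, φ y}

/-- `g` rescales `φ` on `ker l` so that `φ e + g h` represents the image of `e + h`. -/
def IsNormalized (φ : V → V) (e : V) (l : V →ₗ[K] K) (g : V → V) : Prop :=
  ∀ h, l h = 0 → (∃ c : K, c ≠ 0 ∧ φ (e + h) = c • (φ e + g h)) ∧ ∃ c : K, c ≠ 0 ∧ φ h = c • g h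

variable {φ : V → V} {e : V} {l : V →ₗ[K] K} {g : V → V}

namespace SpanPreserving

theorem mem_span_singleton (H : SpanPreserving K φ) (x z : V) :
    z ∈ span K {x} ↔ φ z ∈ span K {φ x} := by
  simpa using H.2 x x z

theorem eq_zero_iff (H : SpanPreserving K φ) (x : V) : φ x = 0 ↔ x = 0 := by
  have := H.mem_span_singleton 0 x
  rw [H.1] at this
  simpa using this.symm

theorem exists_isNormalized (H : SpanPreserving K φ) (he : l e = 1) :
    ∃ g : V → V, IsNormalized φ e l g := by
  suffices h : ∀ h, ∃ y, l h = 0 →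
      (∃ c : K, c ≠ 0 ∧ φ (e + h) = c • (φ e + y)) ∧ ∃ c : K, c ≠ 0 ∧ φ h = c • y by
    choose g hg using h
    exact ⟨g, hg⟩
  intro h
  by_cases h0 : h = 0
  · subst h0
    exact ⟨0, fun _ ↦ ⟨⟨1, one_ne_zero, by simp⟩, 1, one_ne_zero, by simp [H.1]⟩⟩
  by_cases hl : l h = 0
  swap
  · exact ⟨0, fun h' ↦ absurd h' hl⟩
  have hmem : e + h ∈ span K {e, h} :=
    add_mem (subset_span (by simp)) (subset_span (by simp))
  obtain ⟨a, b, hab⟩ := mem_span_pair.1 ((H.2 _ _ _).1 hmem)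
  have ha : a ≠ 0 := by
    rintro rfl
    have : e + h ∈ span K {h} := (H.mem_span_singleton _ _).2
      (Submodule.mem_span_singleton.2 ⟨b, by simpa using hab⟩)
    obtain ⟨k, hk⟩ := Submodule.mem_span_singleton.1 this
    simpa [hl, he] using congrArg l hk
  have hb : b ≠ 0 := by
    rintro rfl
    have : e + h ∈ span K {e} := (H.mem_span_singleton _ _).2
      (Submodule.mem_span_singleton.2 ⟨a, by simpa using hab⟩)
    obtain ⟨k, hk⟩ := Submodule.mem_span_singleton.1 this
    have hk1 : k = 1 := by simpa [hl, he] using congrArg l hk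
    subst hk1
    exact h0 (by simpa using hk)
  refine ⟨(a⁻¹ * b) • φ h, fun _ ↦ ⟨⟨a, ha, ?_⟩, b⁻¹ * a, by simp [ha, hb], ?_⟩⟩
  · rw [← hab, smul_add, smul_smul, mul_inv_cancel_left₀ ha]
  · rw [smul_smul]
    have : b⁻¹ * a * (a⁻¹ * b) = 1 := by field_simp
    rw [this, one_smul]

end SpanPreserving

namespace IsNormalized

theorem map_zero (hg : IsNormalized φ e l g) (H : SpanPreserving K φ) : g 0 = 0 := by
  obtain ⟨-, c, hc, h⟩ := hg 0 (_root_.map_zero l)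
  rw [H.1] at h
  exact (smul_eq_zero.1 h.symm).resolve_left hc

theorem eq_zero_of_map_eq_zero (hg : IsNormalized φ e l g) (H : SpanPreserving K φ) {x : V}
    (hx : l x = 0) (h : g x = 0) : x = 0 := by
  obtain ⟨-, c, hc, h'⟩ := hg x hx
  rw [h, smul_zero] at h'
  exact (H.eq_zero_iff x).1 h'

theorem map_mem_span (hg : IsNormalized φ e l g) {x : V} (hx : l x = 0)
    {S : Submodule K V} : φ x ∈ S ↔ g x ∈ S := by
  obtain ⟨-, c, hc, h'⟩ := hg x hx
  rw [h', S.smul_mem_iff hc]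

theorem span_singleton (hg : IsNormalized φ e l g) {x : V} (hx : l x = 0) :
    span K {φ x} = span K {g x} := by
  obtain ⟨-, c, hc, h'⟩ := hg x hx
  rw [h', span_singleton_smul_eq hc.isUnit]

theorem span_pair (hg : IsNormalized φ e l g) {x y : V} (hx : l x = 0) (hy : l y = 0) :
    span K {φ x, φ y} = span K {g x, g y} := by
  rw [span_insert, span_insert, hg.span_singleton hx, hg.span_singleton hy]

theorem coeff_eq_zero (hg : IsNormalized φ e l g) (H : SpanPreserving K φ) (he : l e = 1)
    {x y : V} (hx : l x = 0) (hy : l y = 0) (hx0 : x ≠ 0) (hxy : y ∉ span K {x})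
    {a b c : K} (h : a • φ e + b • g x + c • g y = 0) : a = 0 ∧ b = 0 ∧ c = 0 := by
  have ha : a = 0 := by
    by_contra ha
    have h1 : a • φ e ∈ span K {g x, g y} :=
      mem_span_pair.2 ⟨-b, -c, by linear_combination (norm := module) -h⟩
    rw [smul_mem_iff _ ha, ← hg.span_pair hx hy, ← H.2] at h1
    obtain ⟨p, q, hpq⟩ := mem_span_pair.1 h1
    have := congrArg l hpq
    simp [hx, hy, he] at this
  subst ha
  have hc : c = 0 := by
    by_contra hc
    have h1 : c • g y ∈ span K {g x} :=
      Submodule.mem_span_singleton.2 ⟨-b, by linear_combination (norm := module) -h⟩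
    rw [smul_mem_iff _ hc, ← hg.map_mem_span hy, ← hg.span_singleton hx,
      ← H.mem_span_singleton] at h1
    exact hxy h1
  subst hc
  refine ⟨rfl, ?_, rfl⟩
  have : b • g x = 0 := by simpa using h
  exact (smul_eq_zero.1 this).resolve_right fun h' ↦ hx0 (hg.eq_zero_of_map_eq_zero H hx h')

theorem map_add_of_notMem_span (hg : IsNormalized φ e l g) (H : SpanPreserving K φ)
    (he : l e = 1) {x y : V} (hx : l x = 0) (hy : l y = 0) (hx0 : x ≠ 0)
    (hxy : y ∉ span K {x}) : g (x + y) = g x + g y := by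
  have hl : l (x + y) = 0 := by simp [hx, hy]
  obtain ⟨⟨t, ht, h1⟩, -⟩ := hg (x + y) hl
  obtain ⟨⟨cx, -, hcx⟩, -⟩ := hg x hx
  obtain ⟨⟨cy, -, hcy⟩, -⟩ := hg y hy
  obtain ⟨-, dx, -, hdx⟩ := hg x hx
  obtain ⟨-, dy, -, hdy⟩ := hg y hy
  have m1 : e + (x + y) ∈ span K {e + x, y} := mem_span_pair.2 ⟨1, 1, by module⟩
  have m2 : e + (x + y) ∈ span K {e + y, x} := mem_span_pair.2 ⟨1, 1, by module⟩
  have m3 : x + y ∈ span K {x, y} := mem_span_pair.2 ⟨1, 1, by module⟩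
  rw [H.2, hg.map_mem_span hl, hg.span_pair hx hy] at m3
  rw [H.2] at m1 m2
  obtain ⟨p, q, h2⟩ := mem_span_pair.1 m1
  obtain ⟨r, s, h3⟩ := mem_span_pair.1 m2
  obtain ⟨u, v, h4⟩ := mem_span_pair.1 m3
  rw [h1, hcx, hdy, ← h4] at h2
  rw [h1, hcy, hdx, ← h4] at h3
  obtain ⟨a1, b1, c1⟩ := hg.coeff_eq_zero H he hx hy hx0 hxy
    (a := p * cx - t) (b := p * cx - t * u) (c := q * dy - t * v)
    (by rw [← sub_eq_zero] at h2; rw [← h2]; module)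
  obtain ⟨a2, b2, c2⟩ := hg.coeff_eq_zero H he hx hy hx0 hxy
    (a := r * cy - t) (b := s * dx - t * u) (c := r * cy - t * v)
    (by rw [← sub_eq_zero] at h3; rw [← h3]; module)
  have hu : u = 1 := mul_left_cancel₀ ht (by linear_combination a1 - b1)
  have hv : v = 1 := mul_left_cancel₀ ht (by linear_combination a2 - c2)
  rw [← h4, hu, hv, one_smul, one_smul]

theorem map_add (hg : IsNormalized φ e l g) (H : SpanPreserving K φ) (he : l e = 1)
    (hdim : ∀ x, ∃ z, l z = 0 ∧ z ∉ span K {x})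
    {x y : V} (hx : l x = 0) (hy : l y = 0) : g (x + y) = g x + g y := by
  by_cases hx0 : x = 0
  · simp [hx0, hg.map_zero H]
  by_cases hxy : y ∈ span K {x}
  swap
  · exact hg.map_add_of_notMem_span H he hx hy hx0 hxy
  obtain ⟨k, rfl⟩ := Submodule.mem_span_singleton.1 hxy
  have hgen : ∀ (c : K) (z : V), l z = 0 → z ∉ span K {x} →
      g (c • x + z) = g (c • x) + g z := by
    intro c z hz hzx
    by_cases hc : c = 0
    · simp [hc, hg.map_zero H]
    · refine hg.map_add_of_notMem_span H he (by simp [hx]) hz (smul_ne_zero hc hx0) ?_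
      rwa [span_singleton_smul_eq (Ne.isUnit hc)]
  obtain ⟨z, hz, hzx⟩ := hdim x
  have hkz : k • x + z ∉ span K {x} := by
    rwa [Submodule.add_mem_iff_right _ hxy]
  have h1 := hgen (1 + k) z hz hzx
  have h2 := hgen 1 (k • x + z) (by simp [hx, hz]) hkz
  have h3 := hgen k z hz hzx
  rw [add_smul, one_smul] at h1
  rw [one_smul, h3, ← add_assoc, h1, ← add_assoc] at h2
  exact add_right_cancel h2

theorem map_smul_of_notMem_span (hg : IsNormalized φ e l g) (H : SpanPreserving K φ)
    (he : l e = 1) (hdim : ∀ x, ∃ z, l z = 0 ∧ z ∉ span K {x})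
    {x y : V} (hx : l x = 0) (hy : l y = 0) (hx0 : x ≠ 0) (hxy : y ∉ span K {x})
    {a r : K} (h : g (a • x) = r • g x) : g (a • y) = r • g y := by
  have hmul : ∀ z, l z = 0 → ∃ s : K, g (a • z) = s • g z := by
    intro z hz
    have hm : a • z ∈ span K {z} := smul_mem _ _ (mem_span_singleton_self z)
    rw [H.mem_span_singleton, hg.map_mem_span (by simp [hz]), hg.span_singleton hz] at hm
    obtain ⟨s, hs⟩ := Submodule.mem_span_singleton.1 hm
    exact ⟨s, hs.symm⟩
  obtain ⟨s, hs⟩ := hmul y hy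
  obtain ⟨t, ht⟩ := hmul (x + y) (by simp [hx, hy])
  rw [smul_add, hg.map_add H he hdim (by simp [hx]) (by simp [hy]), hg.map_add H he hdim hx hy,
    h, hs] at ht
  obtain ⟨-, h1, h2⟩ := hg.coeff_eq_zero H he hx hy hx0 hxy (a := 0) (b := r - t) (c := s - t)
    (by rw [← sub_eq_zero] at ht; rw [← ht]; module)
  rw [hs, sub_eq_zero.1 h1, sub_eq_zero.1 h2]

theorem exists_map_smul (hg : IsNormalized φ e l g) (H : SpanPreserving K φ)
    (he : l e = 1) (hdim : ∀ x, ∃ z, l z = 0 ∧ z ∉ span K {x}) (a : K) :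
    ∃ r : K, ∀ x, l x = 0 → g (a • x) = r • g x := by
  obtain ⟨x, hx, hx0⟩ := hdim 0
  replace hx0 : x ≠ 0 := by simpa using hx0
  obtain ⟨z, hz, hzx⟩ := hdim x
  have hm : a • x ∈ span K {x} := smul_mem _ _ (mem_span_singleton_self x)
  rw [H.mem_span_singleton, hg.map_mem_span (by simp [hx]), hg.span_singleton hx] at hm
  obtain ⟨r, hr⟩ := Submodule.mem_span_singleton.1 hm
  have hrz := hg.map_smul_of_notMem_span H he hdim hx hz hx0 hzx hr.symm
  have hz0 : z ≠ 0 := by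
    rintro rfl
    exact hzx (zero_mem _)
  refine ⟨r, fun y hy ↦ ?_⟩
  by_cases hy0 : y = 0
  · simp [hy0, hg.map_zero H]
  by_cases hyx : y ∈ span K {x}
  · refine hg.map_smul_of_notMem_span H he hdim hz hy hz0 (fun hyz ↦ hzx ?_) hrz
    obtain ⟨k, rfl⟩ := Submodule.mem_span_singleton.1 hyz
    rwa [smul_mem_iff _ (left_ne_zero_of_smul hy0)] at hyx
  · exact hg.map_smul_of_notMem_span H he hdim hx hy hx0 hyx hr.symm

end IsNormalized

/-- A span-preserving map of a space of dimension at least three is, up to scalars, semilinear. -/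
theorem SpanPreserving.exists_semilinear (H : SpanPreserving K φ) (he : l e = 1)
    (hdim : ∀ x, ∃ z, l z = 0 ∧ z ∉ span K {x}) :
    ∃ (ρ : K →+* K) (G : V →ₛₗ[ρ] V), ∀ x, ∃ k : K, φ x = k • G x := by
  obtain ⟨g, hg⟩ := H.exists_isNormalized he
  choose ρ hρ using hg.exists_map_smul H he hdim
  obtain ⟨x₀, hx₀, hx₀0⟩ := hdim 0
  replace hx₀0 : g x₀ ≠ 0 := fun h ↦ hx₀0 (by simp [hg.eq_zero_of_map_eq_zero H hx₀ h])
  have hcancel : ∀ {a b : K}, a • g x₀ = b • g x₀ → a = b :=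
    fun h ↦ smul_left_injective K hx₀0 h
  let σ : K →+* K :=
    { toFun := ρ
      map_one' := hcancel (by rw [← hρ 1 x₀ hx₀, one_smul, one_smul])
      map_zero' := hcancel (by rw [← hρ 0 x₀ hx₀, zero_smul, zero_smul, hg.map_zero H])
      map_add' := fun a b ↦ hcancel (by
        rw [← hρ _ x₀ hx₀, add_smul, hg.map_add H he hdim (by simp [hx₀]) (by simp [hx₀]),
          hρ a x₀ hx₀, hρ b x₀ hx₀, add_smul])
      map_mul' := fun a b ↦ hcancel (by
        rw [← hρ _ x₀ hx₀, mul_smul, hρ a _ (by simp [hx₀]), hρ b x₀ hx₀, mul_smul]) }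
  have hker : ∀ x, l (x - l x • e) = 0 := fun x ↦ by simp [he]
  let G : V →ₛₗ[σ] V :=
    { toFun := fun x ↦ σ (l x) • φ e + g (x - l x • e)
      map_add' := fun x y ↦ by
        have : x + y - l (x + y) • e = (x - l x • e) + (y - l y • e) := by
          rw [_root_.map_add]; module
        rw [this, hg.map_add H he hdim (hker x) (hker y), _root_.map_add, _root_.map_add]
        module
      map_smul' := fun a x ↦ by
        have : a • x - l (a • x) • e = a • (x - l x • e) := by
          rw [_root_.map_smul, smul_eq_mul]; module
        rw [this, hρ a _ (hker x), _root_.map_smul, smul_eq_mul, map_mul, smul_add, mul_smul]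
        rfl }
  have hGker : ∀ h, l h = 0 → G h = g h := fun h hh ↦ by
    change σ (l h) • φ e + g (h - l h • e) = g h
    simp [hh]
  have hGe : G e = φ e := by
    change σ (l e) • φ e + g (e - l e • e) = φ e
    simp [he, hg.map_zero H]
  refine ⟨σ, G, fun x ↦ ?_⟩
  by_cases hx : l x = 0
  · obtain ⟨-, c, -, hc⟩ := hg x hx
    exact ⟨c, by rw [hGker x hx, hc]⟩
  · set h := (l x)⁻¹ • (x - l x • e) with hh
    have hlh : l h = 0 := by rw [hh, _root_.map_smul, hker, smul_zero]
    have hxe : x = l x • (e + h) := by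
      rw [hh, smul_add, smul_smul, mul_inv_cancel₀ hx]; module
    have hm : x ∈ span K {e + h} := Submodule.mem_span_singleton.2 ⟨l x, hxe.symm⟩
    obtain ⟨s, hs⟩ := Submodule.mem_span_singleton.1 ((H.mem_span_singleton _ _).1 hm)
    obtain ⟨⟨c, -, hc⟩, -⟩ := hg h hlh
    have hGx : G x = σ (l x) • (φ e + g h) := by
      conv_lhs => rw [hxe]
      rw [map_smulₛₗ, _root_.map_add, hGe, hGker h hlh]
    have hσ : σ (l x) ≠ 0 := (map_ne_zero σ).2 hx
    refine ⟨s * c * (σ (l x))⁻¹, ?_⟩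
    rw [← hs, hc, hGx, smul_smul, smul_smul, inv_mul_cancel_right₀ hσ]

end SpanPreserving

open Classical in
/-- A choice of representatives for the images of nonzero vectors under a map of projective
points, extended by zero. -/
noncomputable def Projectivization.liftRep {K V : Type*} [Field K] [AddCommGroup V] [Module K V]
    (f : Projectivization K V → Projectivization K V) (x : V) : V :=
  if hx : x = 0 then 0 else (f (Projectivization.mk K x hx)).rep

theorem Projectivization.spanPreserving_liftRep {K V : Type*} [Field K] [AddCommGroup V]
    [Module K V] (f : Projectivization K V → Projectivization K V)
    (hf : ∀ a b c : Projectivization K V,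
      c.rep ∈ span K {a.rep, b.rep} ↔ (f c).rep ∈ span K {(f a).rep, (f b).rep}) :
    SpanPreserving K (liftRep f) := by
  have hsub : ∀ a b c : Projectivization K V,
      c.submodule ≤ a.submodule ⊔ b.submodule ↔
        (f c).submodule ≤ (f a).submodule ⊔ (f b).submodule := by
    intro a b c
    have := hf a b c
    simpa only [span_insert, ← span_singleton_le_iff_mem, ← submodule_eq] using this
  have hspan : ∀ (x : V) (hx : x ≠ 0), span K {x} = (mk K x hx).submodule :=
    fun x hx ↦ (submodule_mk x hx).symm
  have hspan' : ∀ (x : V) (hx : x ≠ 0),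
      span K {liftRep f x} = (f (mk K x hx)).submodule := by
    intro x hx
    rw [liftRep, dif_neg hx, submodule_eq]
  have h0 : liftRep f (0 : V) = 0 := dif_pos rfl
  have hne : ∀ x : V, x ≠ 0 → liftRep f x ≠ 0 := by
    intro x hx
    rw [liftRep, dif_neg hx]
    exact rep_nonzero _
  refine ⟨h0, fun x y z ↦ ?_⟩
  by_cases hz : z = 0
  · simp [hz, h0]
  rw [← span_singleton_le_iff_mem, ← span_singleton_le_iff_mem, span_insert, span_insert]
  by_cases hx : x = 0 <;> by_cases hy : y = 0
  · simp [hx, hy, h0, hz, hne z hz]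
  · subst hx
    rw [h0, hspan y hy, hspan' y hy, hspan z hz, hspan' z hz]
    simpa using hsub (mk K y hy) (mk K y hy) (mk K z hz)
  · subst hy
    rw [h0, hspan x hx, hspan' x hx, hspan z hz, hspan' z hz]
    simpa using hsub (mk K x hx) (mk K x hx) (mk K z hz)
  · rw [hspan x hx, hspan y hy, hspan z hz, hspan' x hx, hspan' y hy, hspan' z hz]
    exact hsub _ _ _

theorem Fin.exists_notMem_span_singleton {K : Type*} [Field K] {n : ℕ} (hn : 2 ≤ n)
    (x : Fin (n + 1) → K) : ∃ z : Fin (n + 1) → K, z 0 = 0 ∧ z ∉ span K {x} := by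
  obtain ⟨m, rfl⟩ := Nat.exists_eq_add_of_le' hn
  by_contra! h
  obtain ⟨a, ha⟩ := Submodule.mem_span_singleton.1
    (h (Pi.single 1 1) (Pi.single_eq_of_ne (by simp) _))
  obtain ⟨b, hb⟩ := Submodule.mem_span_singleton.1
    (h (Pi.single 2 1) (Pi.single_eq_of_ne (by simp [Fin.ext_iff, Nat.mod_eq_of_lt]) _))
  have h12 : (1 : Fin (m + 2 + 1)) ≠ 2 := by simp [Fin.ext_iff, Nat.mod_eq_of_lt]
  have a1 := congrFun ha 1
  have a2 := congrFun ha 2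
  have b2 := congrFun hb 2
  simp [h12.symm] at a1 a2 b2
  rcases a2 with rfl | h2
  · simp at a1
  · simp [h2] at b2


/-- **Fundamental Theorem of Galois Geometry.** Every collineation of
`PG(n,q)`, `n ≥ 2`, i.e. every bijection of the point set preserving the relation "`c` lies in
the projective subspace spanned by `a` and `b`", is induced by a bijective `ρ`-semilinear map
of `F^{n+1}` for some field automorphism `ρ`. -/
theorem stmt12 {F : Type*} [Field F] [Fintype F] {n : ℕ} (hn : 2 ≤ n)
    (f : Equiv.Perm (Projectivization F (Fin (n + 1) → F)))
    (hf : ∀ a b c : Projectivization F (Fin (n + 1) → F),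
      c.rep ∈ Submodule.span F {a.rep, b.rep} ↔
        (f c).rep ∈ Submodule.span F {(f a).rep, (f b).rep}) :
    ∃ (ρ : F ≃+* F) (g : (Fin (n + 1) → F) → (Fin (n + 1) → F)),
      Function.Bijective g ∧
      (∀ x y, g (x + y) = g x + g y) ∧
      (∀ (α : F) (x : Fin (n + 1) → F), g (α • x) = ρ α • g x) ∧
      ∀ (x : Fin (n + 1) → F) (hx : x ≠ 0) (hgx : g x ≠ 0),
        f (Projectivization.mk F x hx) = Projectivization.mk F (g x) hgx := by
  have H := Projectivization.spanPreserving_liftRep f hf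
  obtain ⟨ρ, G, hG⟩ := H.exists_semilinear (l := LinearMap.proj 0) (e := Pi.single 0 1)
    (by simp) (Fin.exists_notMem_span_singleton hn)
  have hinj : Function.Injective G := by
    rw [injective_iff_map_eq_zero]
    intro x hx
    obtain ⟨k, hk⟩ := hG x
    rw [hx, smul_zero] at hk
    exact (H.eq_zero_iff x).1 hk
  refine ⟨RingEquiv.ofBijective ρ (Finite.injective_iff_bijective.1 ρ.injective), G,
    Finite.injective_iff_bijective.1 hinj, map_add G, map_smulₛₗ G, fun x hx hgx ↦ ?_⟩
  obtain ⟨k, hk⟩ := hG x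
  rw [Projectivization.liftRep, dif_neg hx] at hk
  rw [← (f (Projectivization.mk F x hx)).mk_rep, Projectivization.mk_eq_mk_iff']
  exact ⟨k, hk.symm⟩
end

section
/- Let F be a finite field with q elements and k ≥ 3. Suppose σ and τ are bijections of the point set of PG(k−1,q) such that for all points p, h: ⟨rep(h), rep(p)⟩ = 0 if and only if ⟨rep(τ(h)), rep(σ(p))⟩ = 0, where rep(·) denotes any nonzero coordinate representative and ⟨·,·⟩ the standard bilinear form on F^k. Then there exist a field automorphism ρ of F and a bijective ρ-semilinear map g : F^k → F^k such that σ([x]) = [g(x)] for every nonzero x ∈ F^k; that is, every automorphism of the point–hyperplane incidence matrix of PG(k−1,q) is induced by an element of PΓL_k(q). -/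
open Matrix in
/-- A pair of maps on nonzero vectors that preserves orthogonality and the supports of vectors,
and fixes the all-one vector, acts on points as a ring endomorphism of the field applied to
each coordinate. -/
theorem exists_ringHom_of_orthogonality_preserving {F ι : Type*} [Field F] [Fintype ι]
    [DecidableEq ι] (hι : 3 ≤ Fintype.card ι) (S T : (ι → F) → ι → F)
    (hST : ∀ x h, x ≠ 0 → h ≠ 0 → h ⬝ᵥ x = 0 → T h ⬝ᵥ S x = 0)
    (hS : ∀ x i, x ≠ 0 → (S x i = 0 ↔ x i = 0))
    (hT : ∀ h i, h ≠ 0 → (T h i = 0 ↔ h i = 0)) (hS_one : S 1 = 1) :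
    ∃ ρ : F →+* F, ∀ x, x ≠ 0 → ∃ d : F, d ≠ 0 ∧ S x = d • fun i => ρ (x i) := by
  have third (i j : ι) : ∃ l, l ≠ i ∧ l ≠ j := by
    by_contra! hl
    have hsub : (Finset.univ : Finset ι) ⊆ {i, j} := fun l _ => by
      rw [Finset.mem_insert, Finset.mem_singleton]
      exact or_iff_not_imp_left.2 (hl l)
    have := (Finset.card_le_card hsub).trans Finset.card_le_two
    rw [Finset.card_univ] at this
    omega
  have key (i j : ι) (hij : i ≠ j) (c : F) :
      ∃ r : F, ∀ x, x ≠ 0 → x i = c * x j → S x i = r * S x j := by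
    set h : ι → F := Pi.single i 1 - Pi.single j c with hh
    have hi : h i = 1 := by simp [hh, hij]
    have h0 : h ≠ 0 := fun h0 => by simp [h0] at hi
    have hTi : T h i ≠ 0 := by rw [Ne, hT h i h0, hi]; exact one_ne_zero
    refine ⟨-T h j / T h i, fun x hx hxij => ?_⟩
    have horth := hST x h hx h0 (by simp [hh, sub_dotProduct, hxij])
    rw [dotProduct, Fintype.sum_eq_add i j hij] at horth
    · field_simp
      linear_combination horth
    · rintro l ⟨hli, hlj⟩
      rw [(hT h l h0).2 (by simp [hh, hli, hlj]), zero_mul]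
  choose! r hr using key
  have hι1 : (1 : ι → F) ≠ 0 := by
    obtain ⟨i⟩ : Nonempty ι := Fintype.card_pos_iff.1 (by omega)
    exact fun h => one_ne_zero (congrFun h i)
  have r_one (i j : ι) (hij : i ≠ j) : r i j 1 = 1 := by
    have := hr i j hij 1 1 hι1 (by simp)
    simpa [hS_one] using this.symm
  have r_mul (i j l : ι) (hij : i ≠ j) (hil : i ≠ l) (hjl : j ≠ l) (s t : F) :
      r i l (s * t) = r i j s * r j l t := by
    set x : ι → F := Pi.single i (s * t) + Pi.single j t + Pi.single l 1 with hx
    have xi : x i = s * t := by simp [hx, hij, hil]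
    have xj : x j = t := by simp [hx, hij.symm, hjl]
    have xl : x l = 1 := by simp [hx, hil.symm, hjl.symm]
    have x0 : x ≠ 0 := fun h => by simp [h] at xl
    have hSl : S x l ≠ 0 := by rw [Ne, hS x l x0, xl]; exact one_ne_zero
    have h1 := hr i l hil (s * t) x x0 (by rw [xi, xl, mul_one])
    have h2 := hr i j hij s x x0 (by rw [xi, xj])
    have h3 := hr j l hjl t x x0 (by rw [xj, xl, mul_one])
    apply mul_right_cancel₀ hSl
    rw [← h1, h2, h3, mul_assoc]
  have r_fst (i i' j : ι) (hi : i ≠ j) (hi' : i' ≠ j) : r i j = r i' j := by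
    by_cases h : i = i'
    · rw [h]
    · ext c
      simpa [r_one i i' h] using r_mul i i' j h hi hi' 1 c
  have r_snd (i j j' : ι) (hj : i ≠ j) (hj' : i ≠ j') : r i j = r i j' := by
    by_cases h : j = j'
    · rw [h]
    · ext c
      simpa [r_one j j' h] using (r_mul i j j' hj hj' h c 1).symm
  obtain ⟨a⟩ : Nonempty ι := Fintype.card_pos_iff.1 (by omega)
  obtain ⟨b, hba, -⟩ := third a a
  obtain ⟨c, hca, hcb⟩ := third a b
  have r_eq (i j : ι) (hij : i ≠ j) : r i j = r a b := by
    by_cases haj : a = j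
    · subst haj
      obtain ⟨l, hli, hla⟩ := third i a
      rw [r_snd i a l hij hli.symm, r_fst i a l hli.symm hla.symm, r_snd a l b hla.symm hba.symm]
    · rw [r_fst i a j hij haj, r_snd a j b haj hba.symm]
  set ρ := r a b
  have ρ_one : ρ 1 = 1 := r_one a b hba.symm
  have ρ_mul (s t : F) : ρ (s * t) = ρ s * ρ t := by
    have := r_mul a b c hba.symm hca.symm hcb.symm s t
    rwa [r_eq a c hca.symm, r_eq b c hcb.symm] at this
  have hρS (i j : ι) (hij : i ≠ j) (c : F) (x : ι → F) (hx : x ≠ 0) (hxc : x i = c * x j) :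
      S x i = ρ c * S x j := by
    rw [← r_eq i j hij]
    exact hr i j hij c x hx hxc
  have ρ_zero : ρ 0 = 0 := by
    have x0 : (Pi.single b 1 : ι → F) ≠ 0 := by simp
    have h1 := hρS a b hba.symm 0 (Pi.single b 1) x0 (by simp [hba.symm])
    rw [(hS _ a x0).2 (by simp [hba.symm])] at h1
    have h2 : S (Pi.single b 1) b ≠ 0 := by simp [hS _ b x0]
    exact (mul_eq_zero.1 h1.symm).resolve_right h2
  have ρ_add_one (s : F) : ρ (s + 1) = ρ s + 1 := by
    set h : ι → F := Pi.single a 1 - Pi.single b 1 - Pi.single c 1 with hh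
    have hha : h a = 1 := by simp [hh, hba.symm, hca.symm]
    have h0 : h ≠ 0 := fun h0 => by simp [h0] at hha
    have hTa : T h a ≠ 0 := by rw [Ne, hT h a h0, hha]; exact one_ne_zero
    have horth (x : ι → F) (hx : x ≠ 0) (hxabc : x a = x b + x c) :
        T h a * S x a + T h b * S x b + T h c * S x c = 0 := by
      rw [← hST x h hx h0 (by simp [hh, sub_dotProduct, hxabc]), dotProduct,
        ← Finset.sum_subset (Finset.subset_univ {a, b, c})]
      · rw [Finset.sum_insert (by simp [hba.symm, hca.symm]), Finset.sum_pair hcb.symm, add_assoc]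
      · intro l _ hl
        simp only [Finset.mem_insert, Finset.mem_singleton, not_or] at hl
        rw [(hT h l h0).2 (by simp [hh, hl]), zero_mul]
    have coeff (j l : ι) (hja : j ≠ a) (hla : l ≠ a) (hlj : l ≠ j)
        (hjl : ∀ x : ι → F, x ≠ 0 → x a = x j + x l →
          T h a * S x a + T h j * S x j + T h l * S x l = 0) : T h j = -T h a := by
      set x : ι → F := Pi.single a 1 + Pi.single j 1 with hx
      have xa : x a = 1 := by simp [hx, hja.symm]
      have xj : x j = 1 := by simp [hx, hja]
      have xl : x l = 0 := by simp [hx, hla, hlj]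
      have x0 : x ≠ 0 := fun h => by simp [h] at xa
      have h1 := hjl x x0 (by rw [xa, xj, xl, add_zero])
      have h2 := hρS a j hja.symm 1 x x0 (by rw [xa, xj, one_mul])
      have hSj : S x j ≠ 0 := by rw [Ne, hS x j x0, xj]; exact one_ne_zero
      rw [(hS x l x0).2 xl, h2, ρ_one] at h1
      apply mul_right_cancel₀ hSj
      linear_combination h1
    have hb := coeff b c hba hca hcb horth
    have hc := coeff c b hca hba hcb.symm fun x hx hxa => by
      linear_combination horth x hx (by rw [hxa, add_comm])
    set x : ι → F := Pi.single a (s + 1) + Pi.single b s + Pi.single c 1 with hx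
    have xa : x a = s + 1 := by simp [hx, hba.symm, hca.symm]
    have xb : x b = s := by simp [hx, hba, hcb.symm]
    have xc : x c = 1 := by simp [hx, hca, hcb]
    have x0 : x ≠ 0 := fun h => by simp [h] at xc
    have hSc : S x c ≠ 0 := by rw [Ne, hS x c x0, xc]; exact one_ne_zero
    have h1 := horth x x0 (by rw [xa, xb, xc])
    rw [hb, hc, hρS a c hca.symm (s + 1) x x0 (by rw [xa, xc, mul_one]),
      hρS b c hcb.symm s x x0 (by rw [xb, xc, mul_one])] at h1
    apply mul_right_cancel₀ hSc
    apply mul_left_cancel₀ hTa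
    linear_combination h1
  have ρ_add (s t : F) : ρ (s + t) = ρ s + ρ t := by
    by_cases ht : t = 0
    · rw [ht, add_zero, ρ_zero, add_zero]
    · rw [show s + t = (s / t + 1) * t by field_simp, ρ_mul, ρ_add_one, add_mul, one_mul, ← ρ_mul,
        div_mul_cancel₀ _ ht]
  let ρ' : F →+* F :=
    { toFun := ρ, map_one' := ρ_one, map_mul' := ρ_mul, map_zero' := ρ_zero, map_add' := ρ_add }
  refine ⟨ρ', fun x hx => ?_⟩
  obtain ⟨j, hj⟩ := Function.ne_iff.1 hx
  have hρj : ρ' (x j) ≠ 0 := (map_ne_zero ρ').2 hj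
  refine ⟨S x j / ρ' (x j), div_ne_zero (mt (hS x j hx).1 hj) hρj, ?_⟩
  ext i
  rw [Pi.smul_apply, smul_eq_mul]
  by_cases hij : i = j
  · rw [hij, div_mul_cancel₀ _ hρj]
  · have h1 : S x i = ρ' (x i / x j) * S x j :=
      hρS i j hij (x i / x j) x hx (by rw [div_mul_cancel₀ _ hj])
    rw [h1, map_div₀]
    ring

open Matrix in
/-- A pair of maps on nonzero vectors that preserves and reflects orthogonality acts on points,
up to an invertible matrix, as a ring endomorphism applied to each coordinate. -/
theorem exists_ringHom_matrix_of_orthogonality_iff {F ι : Type*} [Field F] [Fintype ι]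
    [DecidableEq ι] (hι : 3 ≤ Fintype.card ι) (S T : (ι → F) → ι → F)
    (hST : ∀ x h, x ≠ 0 → h ≠ 0 → (h ⬝ᵥ x = 0 ↔ T h ⬝ᵥ S x = 0)) :
    ∃ (ρ : F →+* F) (A : Matrix ι ι F), IsUnit A.det ∧
      ∀ x, x ≠ 0 → ∃ d : F, d ≠ 0 ∧ A *ᵥ S x = d • fun i => ρ (x i) := by
  have hι1 : (1 : ι → F) ≠ 0 := by
    obtain ⟨i⟩ : Nonempty ι := Fintype.card_pos_iff.1 (by omega)
    exact fun h => one_ne_zero (congrFun h i)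
  have he (i : ι) : (Pi.single i 1 : ι → F) ≠ 0 := by simp
  have hc (i : ι) : T (Pi.single i 1) ⬝ᵥ S 1 ≠ 0 := by
    rw [Ne, ← hST _ _ hι1 (he i)]
    simp
  let A : Matrix ι ι F :=
    Matrix.of fun i => (T (Pi.single i 1) ⬝ᵥ S 1)⁻¹ • T (Pi.single i 1)
  have hA (v : ι → F) (i : ι) :
      (A *ᵥ v) i = (T (Pi.single i 1) ⬝ᵥ S 1)⁻¹ * (T (Pi.single i 1) ⬝ᵥ v) := by
    change ((T (Pi.single i 1) ⬝ᵥ S 1)⁻¹ • T (Pi.single i 1)) ⬝ᵥ v = _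
    rw [smul_dotProduct, smul_eq_mul]
  have hS (x : ι → F) (i : ι) (hx : x ≠ 0) : (A *ᵥ S x) i = 0 ↔ x i = 0 := by
    rw [hA, mul_eq_zero, or_iff_right (inv_ne_zero (hc i)), ← hST _ _ hx (he i)]
    simp
  have hAe (j : ι) : A *ᵥ S (Pi.single j 1) = Pi.single j ((A *ᵥ S (Pi.single j 1)) j) := by
    ext i
    by_cases hij : i = j
    · subst hij; simp
    · rw [(hS _ i (he j)).2 (by simp [hij]), Pi.single_eq_of_ne hij]
  have hd (j : ι) : (A *ᵥ S (Pi.single j 1)) j ≠ 0 := by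
    rw [Ne, hS _ j (he j)]
    simp
  have hdet : IsUnit A.det := by
    have hAU : A * (Matrix.of fun i j => S (Pi.single j 1) i) =
        Matrix.diagonal fun j => (A *ᵥ S (Pi.single j 1)) j := by
      ext i j
      change (A *ᵥ S (Pi.single j 1)) i = _
      rw [hAe j, Matrix.diagonal_apply]
      by_cases hij : i = j
      · subst hij; simp
      · simp [hij]
    have := congrArg Matrix.det hAU
    rw [Matrix.det_mul, Matrix.det_diagonal] at this
    refine isUnit_iff_ne_zero.2 fun hA0 => (Finset.prod_ne_zero_iff (s := Finset.univ)).2 (fun j _ => hd j) ?_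
    rw [← this, hA0, zero_mul]
  have hT (h v : ι → F) : (T h ᵥ* A⁻¹) ⬝ᵥ (A *ᵥ v) = T h ⬝ᵥ v := by
    rw [← Matrix.dotProduct_mulVec, Matrix.mulVec_mulVec, Matrix.nonsing_inv_mul _ hdet,
      Matrix.one_mulVec]
  obtain ⟨ρ, hρ⟩ := exists_ringHom_of_orthogonality_preserving hι (fun x => A *ᵥ S x)
    (fun h => T h ᵥ* A⁻¹)
    (fun x h hx hh hhx => by rw [hT]; exact (hST x h hx hh).1 hhx) hS
    (fun h i hh => by
      have := hT h (S (Pi.single i 1))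
      rw [hAe i, dotProduct_single] at this
      have h1 := hST _ h (he i) hh
      rw [← this, mul_eq_zero, or_iff_left (hd i), dotProduct_single, mul_one] at h1
      exact h1.symm)
    (by ext i; rw [hA, inv_mul_cancel₀ (hc i), Pi.one_apply])
  exact ⟨ρ, A, hdet, hρ⟩

/-- Every automorphism of the point–hyperplane incidence matrix of
`PG(k-1,q)`, `k ≥ 3`, i.e. every pair of bijections `σ, τ` of the point set preserving the
vanishing of the standard bilinear form on representatives, is induced (in its point component
`σ`) by a bijective `ρ`-semilinear map of `F^k`, i.e. by an element of `PΓL_k(q)`. -/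
theorem stmt14 {F : Type*} [Field F] [Fintype F] {k : ℕ} (hk : 3 ≤ k)
    (σ τ : Equiv.Perm (Projectivization F (Fin k → F)))
    (hστ : ∀ p h : Projectivization F (Fin k → F),
      (∑ i, h.rep i * p.rep i) = 0 ↔ (∑ i, (τ h).rep i * (σ p).rep i) = 0) :
    ∃ (ρ : F ≃+* F) (g : (Fin k → F) → (Fin k → F)),
      Function.Bijective g ∧
      (∀ x y, g (x + y) = g x + g y) ∧
      (∀ (α : F) (x : Fin k → F), g (α • x) = ρ α • g x) ∧
      ∀ (x : Fin k → F) (hx : x ≠ 0) (hgx : g x ≠ 0),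
        σ (Projectivization.mk F x hx) = Projectivization.mk F (g x) hgx := by
  classical
  let S : (Fin k → F) → Fin k → F := fun x =>
    if hx : x ≠ 0 then (σ (Projectivization.mk F x hx)).rep else 0
  let T : (Fin k → F) → Fin k → F := fun x =>
    if hx : x ≠ 0 then (τ (Projectivization.mk F x hx)).rep else 0
  have hST (x h : Fin k → F) (hx : x ≠ 0) (hh : h ≠ 0) :
      h ⬝ᵥ x = 0 ↔ T h ⬝ᵥ S x = 0 := by
    simp only [S, T, dif_pos hx, dif_pos hh]
    refine Iff.trans ?_ (hστ (Projectivization.mk F x hx) (Projectivization.mk F h hh))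
    obtain ⟨a, ha⟩ := Projectivization.exists_smul_eq_mk_rep F x hx
    obtain ⟨b, hb⟩ := Projectivization.exists_smul_eq_mk_rep F h hh
    change _ ↔ (Projectivization.mk F h hh).rep ⬝ᵥ (Projectivization.mk F x hx).rep = 0
    rw [← ha, ← hb, Units.smul_def, Units.smul_def, smul_dotProduct, dotProduct_smul]
    simp
  obtain ⟨ρ, A, hA, hρ⟩ :=
    exists_ringHom_matrix_of_orthogonality_iff (by simpa using hk) S T hST
  have hρ_bij : Function.Bijective ρ := Finite.injective_iff_bijective.1 ρ.injective
  refine ⟨RingEquiv.ofBijective ρ hρ_bij, fun x => A⁻¹.mulVec fun i => ρ (x i), ?_, ?_, ?_, ?_⟩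
  · refine Finite.injective_iff_bijective.1 fun x y hxy => ?_
    have := congrArg A.mulVec hxy
    simp only [Matrix.mulVec_mulVec, Matrix.mul_nonsing_inv _ hA, Matrix.one_mulVec] at this
    exact funext fun i => ρ.injective (congrFun this i)
  · intro x y
    rw [← Matrix.mulVec_add]
    exact congrArg A⁻¹.mulVec (funext fun _ => map_add ρ _ _)
  · intro α x
    rw [← Matrix.mulVec_smul]
    exact congrArg A⁻¹.mulVec (funext fun _ => map_mul ρ _ _)
  · intro x hx hgx
    obtain ⟨d, -, hd⟩ := hρ x hx
    rw [← Projectivization.mk_rep (σ (Projectivization.mk F x hx)),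
      Projectivization.mk_eq_mk_iff']
    refine ⟨d, ?_⟩
    rw [← Matrix.mulVec_smul, ← hd, Matrix.mulVec_mulVec, Matrix.nonsing_inv_mul _ hA,
      Matrix.one_mulVec]
    exact dif_pos hx
end
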